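/- There exists a constant C > 0 such that for every prime p and every natural number m, f(p^m) ≥ p^{(2/27)m³ − C·m²}. -/

import Mathlib

/-- Two group structures give isomorphic groups. -/
def GroupIsoOf {α β : Type} (g : Group α) (h : Group β) : Prop :=
  letI := g; letI := h; Nonempty (α ≃* β)

/-- The number of isomorphism classes of groups of order `n` lying in the class `S`
(a class of groups closed under isomorphism, given as a predicate on group structures). -/
noncomputable def numGroups (n : ℕ) (S : (G : Type) → Group G → Prop) : ℕ :=
  Nat.card (Quot fun g h : {g : Group (Fin n) // S (Fin n) g} => GroupIsoOf g.1 h.1)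

/-- Parameters: structure constants indexed by pairs `i < j` in `Fin r`, with values in `𝔽_p^s`. -/
abbrev HigPar (p r s : ℕ) : Type := (Σ j : Fin r, Fin j.1) → Fin s → ZMod p

/-- The bilinear cocycle. -/
def higBeta {p r s : ℕ} (c : HigPar p r s) (v w : Fin r → ZMod p) : Fin s → ZMod p :=
  fun k => ∑ x : (Σ j : Fin r, Fin j.1), v x.1 * w ⟨x.2.1, x.2.2.trans x.1.2⟩ * c x k

lemma higBeta_add_left {p r s : ℕ} (c : HigPar p r s) (v v' w : Fin r → ZMod p) :
    higBeta c (v + v') w = higBeta c v w + higBeta c v' w := by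
  ext k
  simp [higBeta, add_mul, Finset.sum_add_distrib]

lemma higBeta_add_right {p r s : ℕ} (c : HigPar p r s) (v w w' : Fin r → ZMod p) :
    higBeta c v (w + w') = higBeta c v w + higBeta c v w' := by
  ext k
  simp [higBeta, add_mul, mul_add, Finset.sum_add_distrib]

lemma higBeta_zero_left {p r s : ℕ} (c : HigPar p r s) (w : Fin r → ZMod p) :
    higBeta c 0 w = 0 := by
  ext k
  simp [higBeta]

lemma higBeta_zero_right {p r s : ℕ} (c : HigPar p r s) (w : Fin r → ZMod p) :
    higBeta c w 0 = 0 := by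
  ext k
  simp [higBeta]

lemma higBeta_neg_left {p r s : ℕ} (c : HigPar p r s) (v w : Fin r → ZMod p) :
    higBeta c (-v) w = - higBeta c v w := by
  ext k
  simp [higBeta]

/-- The underlying type of the group. -/
def HigG {p r s : ℕ} (_ : HigPar p r s) : Type := (Fin r → ZMod p) × (Fin s → ZMod p)

/-- Constructor. -/
def HigG.mk {p r s : ℕ} (c : HigPar p r s) (a : Fin r → ZMod p) (b : Fin s → ZMod p) : HigG c :=
  (a, b)

instance higGroup {p r s : ℕ} (c : HigPar p r s) : Group (HigG c) where
  mul x y := (x.1 + y.1, x.2 + y.2 + higBeta c x.1 y.1)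
  one := (0, 0)
  inv x := (-x.1, -x.2 + higBeta c x.1 x.1)
  mul_assoc x y z := by
    refine Prod.ext ?_ ?_
    · exact add_assoc x.1 y.1 z.1
    · change x.2 + y.2 + higBeta c x.1 y.1 + z.2 + higBeta c (x.1 + y.1) z.1 =
        x.2 + (y.2 + z.2 + higBeta c y.1 z.1) + higBeta c x.1 (y.1 + z.1)
      rw [higBeta_add_left, higBeta_add_right]
      abel
  one_mul x := by
    refine Prod.ext ?_ ?_
    · exact zero_add x.1
    · change 0 + x.2 + higBeta c 0 x.1 = x.2
      simp [higBeta_zero_left]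
  mul_one x := by
    refine Prod.ext ?_ ?_
    · exact add_zero x.1
    · change x.2 + 0 + higBeta c x.1 0 = x.2
      simp [higBeta_zero_right]
  inv_mul_cancel x := by
    refine Prod.ext ?_ ?_
    · exact neg_add_cancel x.1
    · change -x.2 + higBeta c x.1 x.1 + x.2 + higBeta c (-x.1) x.1 = 0
      rw [higBeta_neg_left]
      abel

lemma HigG.mul_def {p r s : ℕ} (c : HigPar p r s) (a a' : Fin r → ZMod p) (b b' : Fin s → ZMod p) :
    HigG.mk c a b * HigG.mk c a' b' = HigG.mk c (a + a') (b + b' + higBeta c a a') := rfl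

/-- The central embedding. -/
def higIota {p r s : ℕ} (c : HigPar p r s) : (Fin s → ZMod p) →+ Additive (HigG c) where
  toFun w := Additive.ofMul (HigG.mk c 0 w)
  map_zero' := rfl
  map_add' x y := by
    change HigG.mk c 0 (x + y) = HigG.mk c 0 x * HigG.mk c 0 y
    rw [HigG.mul_def, higBeta_zero_left]
    simp

/-- The generators. -/
def higGen {p r s : ℕ} (c : HigPar p r s) : Fin r ⊕ Fin s → HigG c
  | Sum.inl i => HigG.mk c (Pi.single i 1) 0
  | Sum.inr k => HigG.mk c 0 (Pi.single k 1)

lemma higGen_comm {p r s : ℕ} (c : HigPar p r s) (x : Σ j : Fin r, Fin j.1) :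
    higGen c (Sum.inl x.1) * higGen c (Sum.inl ⟨x.2.1, x.2.2.trans x.1.2⟩) =
      higGen c (Sum.inl ⟨x.2.1, x.2.2.trans x.1.2⟩) * higGen c (Sum.inl x.1) *
        HigG.mk c 0 (c x) := by
  obtain ⟨j, i⟩ := x
  have h1 : higBeta c (Pi.single j 1) (Pi.single ⟨i.1, i.2.trans j.2⟩ 1) = c ⟨j, i⟩ := by
    ext k
    unfold higBeta
    rw [Finset.sum_eq_single ⟨j, i⟩]
    · simp
    · rintro ⟨j', i'⟩ - hne
      by_cases hj : j' = j
      · subst hj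
        have : i' ≠ i := fun h => hne (by rw [h])
        have h2 : i'.1 ≠ i.1 := fun h => this (Fin.ext h)
        simp [Pi.single_apply, h2]
      · simp [Pi.single_apply, hj]
    · simp
  have h2 : higBeta c (Pi.single ⟨i.1, i.2.trans j.2⟩ 1) (Pi.single j 1) = 0 := by
    ext k
    unfold higBeta
    apply Finset.sum_eq_zero
    rintro ⟨j', i'⟩ -
    have h3 : ¬ (j'.1 = i.1 ∧ i'.1 = j.1) := by
      have := i'.2
      have := i.2
      omega
    simp only [Pi.single_apply, Fin.ext_iff]
    split_ifs <;> simp_all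
  simp only [higGen]
  rw [HigG.mul_def, HigG.mul_def, HigG.mul_def, h1, h2, higBeta_zero_right]
  refine Prod.ext ?_ ?_
  · change Pi.single j 1 + _ = _ + Pi.single j 1 + 0
    rw [add_zero, add_comm]
  · change 0 + 0 + c ⟨j, i⟩ = 0 + 0 + 0 + c ⟨j, i⟩ + 0
    simp

lemma higEmb {p r s : ℕ} [Fact p.Prime] {c c' : HigPar p r s} {H : Type} [Group H]
    (f : HigG c →* H) (f' : HigG c' →* H) (hf' : Function.Injective f')
    (h : ∀ x, f (higGen c x) = f' (higGen c' x)) : c = c' := by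
  let F : (Fin s → ZMod p) →+ Additive H := (MonoidHom.toAdditive f).comp (higIota c)
  let F' : (Fin s → ZMod p) →+ Additive H := (MonoidHom.toAdditive f').comp (higIota c')
  have key : ∀ w, w ∈ AddMonoidHom.eqLocus F F' := by
    intro w
    have hw : w = ∑ k, Pi.single k (w k) := (Finset.univ_sum_single w).symm
    rw [hw]
    apply AddSubgroup.sum_mem
    intro k _
    have : (Pi.single k (w k) : Fin s → ZMod p) = (w k).val • Pi.single k (1 : ZMod p) := by
      rw [← Pi.single_smul]
      simp
    rw [this]
    apply AddSubgroup.nsmul_mem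
    exact h (Sum.inr k)
  have key' : ∀ w, f (HigG.mk c 0 w) = f' (HigG.mk c' 0 w) := key
  funext x
  have e1 := congrArg f (higGen_comm c x)
  have e2 := congrArg f' (higGen_comm c' x)
  simp only [map_mul, h] at e1 e2
  rw [e1, mul_right_inj, key'] at e2
  exact congrArg Prod.snd (hf' e2)

lemma higFinite (α : Type) [Finite α] : Finite (Group α) := by
  refine Finite.of_injective
    (fun g : Group α => (letI := g; (HMul.hMul : α → α → α))) ?_
  intro g h hgh
  exact Group.ext hgh

lemma groupIsoOf_refl {α : Type} (g : Group α) : GroupIsoOf g g := ⟨MulEquiv.refl _⟩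

lemma groupIsoOf_symm {α β : Type} (g : Group α) (h : Group β) (H : GroupIsoOf g h) :
    GroupIsoOf h g := by
  obtain ⟨e⟩ := H
  exact ⟨e.symm⟩

lemma groupIsoOf_trans {α β γ : Type} (g : Group α) (h : Group β) (k : Group γ)
    (H : GroupIsoOf g h) (K : GroupIsoOf h k) : GroupIsoOf g k := by
  obtain ⟨e⟩ := H
  obtain ⟨e'⟩ := K
  exact ⟨e.trans e'⟩

lemma groupIsoOf_transfer {α β : Type} (e : α ≃ β) (h : Group β) :
    GroupIsoOf h (@Equiv.group _ _ e h) := by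
  letI := Equiv.group e
  exact ⟨(Equiv.mulEquiv e).symm⟩

lemma groupIsoOf_hom {α β : Type} (g : Group α) (h : Group β) (H : GroupIsoOf g h) :
    ∃ F : α →* β, Function.Injective F := by
  obtain ⟨e⟩ := H
  exact ⟨e.toMonoidHom, e.injective⟩

lemma groupIsoOf_equivalence (n : ℕ) : Equivalence
    (fun g h : {g : Group (Fin n) // (fun _ _ => True : (G : Type) → Group G → Prop) (Fin n) g} =>
      GroupIsoOf g.1 h.1) where
  refl g := groupIsoOf_refl g.1
  symm {g h} := groupIsoOf_symm g.1 h.1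
  trans {g h k} := groupIsoOf_trans g.1 h.1 k.1

lemma higEmb' {p r s : ℕ} [Fact p.Prime] {c c' : HigPar p r s} {H : Type} (g : Group H)
    (f : HigG c → H) (f' : HigG c' → H)
    (hf : ∃ F : HigG c →* H, (F : HigG c → H) = f ∧ Function.Injective F)
    (hf' : ∃ F : HigG c' →* H, (F : HigG c' → H) = f' ∧ Function.Injective F)
    (h : ∀ x, f (higGen c x) = f' (higGen c' x)) : c = c' := by
  obtain ⟨F, rfl, -⟩ := hf
  obtain ⟨F', rfl, hinj⟩ := hf'
  exact higEmb F F' hinj h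

/-- `f` is an injective homomorphism. -/
def IsInjHom {α β : Type} (g : Group α) (h : Group β) (f : α → β) : Prop :=
  ∃ F : α →* β, (F : α → β) = f ∧ Function.Injective F

lemma higCount (p r s : ℕ) [Fact p.Prime] :
    p ^ (s * (r * (r - 1) / 2)) ≤
      numGroups (p ^ (r + s)) (fun _ _ => True) * p ^ ((r + s) * (r + s)) := by
  set n := p ^ (r + s) with hn
  let X := {g : Group (Fin n) // (fun _ _ => True : (G : Type) → Group G → Prop) (Fin n) g}
  let R : X → X → Prop := fun g h => GroupIsoOf g.1 h.1
  have : Finite (Group (Fin n)) := higFinite _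
  have hfin : Finite (Quot R) := inferInstance
  have hcard : Fintype.card ((Fin r → ZMod p) × (Fin s → ZMod p)) = Fintype.card (Fin n) := by
    simp [ZMod.card, hn, pow_add]
  let E := Fintype.equivOfCardEq hcard
  let gg : HigPar p r s → X := fun c =>
    ⟨@Equiv.group _ _ (show Fin n ≃ HigG c from E.symm) (higGroup c), trivial⟩
  have hiso : ∀ c, ∃ f : HigG c → Fin n,
      IsInjHom (higGroup c) (Quot.out (Quot.mk R (gg c))).1 f := by
    intro c
    have h1 : R (gg c) (Quot.out (Quot.mk R (gg c))) := by
      have := Quot.eqvGen_exact (Quot.out_eq (Quot.mk R (gg c)))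
      exact (groupIsoOf_equivalence n).symm
        (((groupIsoOf_equivalence n).eqvGen_iff).1 this)
    have h2 : GroupIsoOf (higGroup c) (gg c).1 := groupIsoOf_transfer _ _
    obtain ⟨F, hF⟩ := groupIsoOf_hom _ _ (groupIsoOf_trans _ _ _ h2 h1)
    exact ⟨F, F, rfl, hF⟩
  choose f hf using hiso
  let Φ : HigPar p r s → Quot R × (Fin r ⊕ Fin s → Fin n) :=
    fun c => (Quot.mk R (gg c), fun x => f c (higGen c x))
  have hΦ : Function.Injective Φ := by
    intro c c' hcc
    have h1 : Quot.mk R (gg c) = Quot.mk R (gg c') := congrArg Prod.fst hcc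
    have h2 : ∀ x, f c (higGen c x) = f c' (higGen c' x) := congrFun (congrArg Prod.snd hcc)
    have a := hf c
    have b := hf c'
    rw [h1] at a
    exact higEmb' _ _ _ a b h2
  have hle := Nat.card_le_card_of_injective Φ hΦ
  have hs : ∑ j : Fin r, j.1 = r * (r - 1) / 2 := by
    rw [Fin.sum_univ_eq_sum_range (fun i => i) r, Finset.sum_range_id]
  have hL : Nat.card (HigPar p r s) = p ^ (s * (r * (r - 1) / 2)) := by
    rw [Nat.card_eq_fintype_card]
    simp [ZMod.card, hs, ← pow_mul]
  rw [hL, Nat.card_prod] at hle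
  refine hle.trans (le_of_eq ?_)
  congr 1
  rw [Nat.card_eq_fintype_card]
  simp [hn, ← pow_mul]

/-- Higman.  There is a constant `C > 0` with
`f(p^m) ≥ p^{(2/27)m³ − C·m²}` for every prime `p` and every `m`. -/
theorem higman_lower_bound :
    ∃ C : ℝ, 0 < C ∧ ∀ p m : ℕ, p.Prime →
      (p : ℝ) ^ ((2 / 27 : ℝ) * (m : ℝ) ^ 3 - C * (m : ℝ) ^ 2) ≤
        (numGroups (p ^ m) (fun _ _ => True) : ℝ) := by
  refine ⟨2, by norm_num, ?_⟩
  intro p m hp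
  have : Fact p.Prime := ⟨hp⟩
  obtain ⟨s, hs⟩ : ∃ s, s = m / 3 := ⟨_, rfl⟩
  obtain ⟨r, hr⟩ : ∃ r, r = m - s := ⟨_, rfl⟩
  have hrs : r + s = m := by omega
  have h := higCount p r s
  rw [hrs] at h
  have hp1 : (1 : ℝ) ≤ p := by exact_mod_cast hp.one_lt.le
  have hp0 : (0 : ℝ) < p := by linarith
  have hR : (p : ℝ) ^ (s * (r * (r - 1) / 2)) ≤
      numGroups (p ^ m) (fun _ _ => True) * (p : ℝ) ^ (m * m) := by exact_mod_cast h
  have hexp : (2 / 27 : ℝ) * (m : ℝ) ^ 3 - 2 * (m : ℝ) ^ 2 + (m * m : ℕ) ≤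
      ((s * (r * (r - 1) / 2) : ℕ) : ℝ) := by
    have h2 : ((r * (r - 1) / 2 : ℕ) : ℝ) = (r : ℝ) * (r - 1) / 2 := by
      rw [← Nat.choose_two_right, Nat.cast_choose_two]
    push_cast [h2]
    have a1 : (m : ℝ) ≤ 3 * s + 2 := by
      have : m ≤ 3 * s + 2 := by omega
      exact_mod_cast this
    have a2 : 3 * (s : ℝ) ≤ m := by
      have : 3 * s ≤ m := by omega
      exact_mod_cast this
    have a3 : (r : ℝ) = m - s := by
      have : (r : ℝ) + s = m := by exact_mod_cast hrs
      linarith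
    have a0 : (0 : ℝ) ≤ s := by positivity
    obtain ⟨t, ht⟩ : ∃ t : ℝ, t = m - 3 * s := ⟨_, rfl⟩
    have hm : (m : ℝ) = 3 * s + t := by linarith
    have t0 : 0 ≤ t := by linarith
    have t2 : t ≤ 2 := by linarith
    rw [a3, hm]
    nlinarith [mul_nonneg a0 t0, mul_nonneg (mul_nonneg a0 t0) t0, mul_nonneg (mul_nonneg a0 a0) t0,
      mul_nonneg t0 (sub_nonneg.2 t2), mul_nonneg (mul_nonneg t0 t0) (sub_nonneg.2 t2), sq_nonneg t,
      mul_nonneg a0 a0]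
  have hpos : (0 : ℝ) < (p : ℝ) ^ (m * m) := by positivity
  refine le_of_mul_le_mul_right ?_ hpos
  refine le_trans ?_ hR
  rw [← Real.rpow_natCast (p : ℝ) (m * m), ← Real.rpow_natCast (p : ℝ) (s * _), ← Real.rpow_add hp0]
  exact Real.rpow_le_rpow_of_exponent_le hp1 hexp
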